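/- If a probability density function p : ℝ^d → ℝ (a Lebesgue-measurable, almost everywhere non-negative function with Lebesgue integral equal to 1) is continuous at Lebesgue-almost every point of ℝ^d, then p admits a non-negative Lipschitz spectrum with smooth marginals: there exist a non-negative sequence (w_i)_{i=1}^∞ with ∑_{i=1}^∞ w_i = 1, a sequence of constants (L_i)_{i=1}^∞, and functions p_{i,j} : ℝ → ℝ for i ∈ ℕ, j ∈ {1,…,d}, each a smooth (infinitely differentiable) probability density function that is L_i-Lipschitz continuous, such that p(x_1,…,x_d) = ∑_{i=1}^∞ w_i ∏_{j=1}^d p_{i,j}(x_j) almost everywhere (the series converging in L¹). -/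

import Mathlib

open MeasureTheory Filter Finset

noncomputable section

/-- A pdf on `ℝ`: a Lebesgue-measurable, a.e. non-negative function with integral one. -/
def IsPdf1 (f : ℝ → ℝ) : Prop :=
  Measurable f ∧ (∀ᵐ x ∂(volume : Measure ℝ), 0 ≤ f x) ∧ ∫ x, f x = 1


/-- indicator of the half-open unit interval -/
def uind (t : ℝ) : ℝ := if ⌊t⌋ = 0 then 1 else 0

lemma uind_nonneg (t : ℝ) : 0 ≤ uind t := by unfold uind; split_ifs <;> norm_num

lemma uind_eq_indicator : uind = Set.indicator (Set.Ico (0:ℝ) 1) (fun _ => (1:ℝ)) := by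
  funext t
  unfold uind
  simp only [Set.indicator, Set.mem_Ico, Int.floor_eq_iff, Int.cast_zero, zero_add]

lemma uind_integrable : Integrable uind := by
  rw [uind_eq_indicator]
  exact (integrable_indicator_iff measurableSet_Ico).2 (by simp)

lemma uind_integral : ∫ t, uind t = 1 := by
  rw [uind_eq_indicator, integral_indicator measurableSet_Ico]
  simp

lemma resc_integrable {φ : ℝ → ℝ} (hφ : Integrable φ) (K : ℝ) (hK : K ≠ 0) (n : ℝ) :
    Integrable (fun t => φ (K * t - n)) :=
  (hφ.comp_sub_right n).comp_mul_left' hK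

lemma resc_integral (φ : ℝ → ℝ) (K : ℝ) (hK : 0 < K) (n : ℝ) :
    ∫ t, φ (K * t - n) = K⁻¹ * ∫ t, φ t := by
  rw [Measure.integral_comp_mul_left (fun t => φ (t - n)) K, integral_sub_right_eq_self]
  rw [abs_of_pos (inv_pos.2 hK), smul_eq_mul]

lemma box_integrable {d : ℕ} {φ : ℝ → ℝ} (hφ : Integrable φ) (K : ℝ) (hK : K ≠ 0) (n : Fin d → ℤ) :
    Integrable (fun x : Fin d → ℝ => ∏ j, φ (K * x j - n j)) :=
  Integrable.fintype_prod (f := fun (j : Fin d) t => φ (K * t - n j))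
    (fun j => resc_integrable hφ K hK _)

lemma box_integral {d : ℕ} (φ : ℝ → ℝ) (K : ℝ) (hK : 0 < K) (n : Fin d → ℤ) :
    ∫ x : Fin d → ℝ, ∏ j, φ (K * x j - n j) = (K⁻¹ * ∫ t, φ t) ^ d := by
  rw [integral_fintype_prod_volume_eq_prod (fun (j : Fin d) t => φ (K * t - n j))]
  simp [resc_integral φ K hK]

/-- index of the cube containing `x` -/
def cidx {d : ℕ} (K : ℝ) (x : Fin d → ℝ) : Fin d → ℤ := fun j => ⌊K * x j⌋

lemma prod_uind {d : ℕ} (K : ℝ) (x : Fin d → ℝ) (n : Fin d → ℤ) :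
    ∏ j, uind (K * x j - n j) = if n = cidx K x then 1 else 0 := by
  unfold uind
  rw [Finset.prod_ite_zero]
  simp only [Int.floor_sub_intCast, sub_eq_zero, Finset.mem_univ, forall_true_left,
    Finset.prod_const_one, funext_iff, cidx]
  congr 1
  exact propext ⟨fun h j => (h j).symm, fun h j => (h j).symm⟩

lemma sum_uind {d : ℕ} (K : ℝ) (x : Fin d → ℝ) (S : Finset (Fin d → ℤ)) (a : (Fin d → ℤ) → ℝ) :
    ∑ n ∈ S, a n * ∏ j, uind (K * x j - n j) = if cidx K x ∈ S then a (cidx K x) else 0 := by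
  simp only [prod_uind, mul_ite, mul_one, mul_zero, Finset.sum_ite_eq']

/-- infimum of `f` over the cube with index `n` -/
def cinf {d : ℕ} (f : (Fin d → ℝ) → ℝ) (K : ℝ) (n : Fin d → ℤ) : ℝ :=
  sInf (f '' {y | cidx K y = n})

lemma cinf_nonneg {d : ℕ} {f : (Fin d → ℝ) → ℝ} (hf : ∀ x, 0 ≤ f x) (K : ℝ) (n : Fin d → ℤ) :
    0 ≤ cinf f K n := by
  apply Real.sInf_nonneg
  rintro _ ⟨y, -, rfl⟩
  exact hf y

lemma cinf_le {d : ℕ} {f : (Fin d → ℝ) → ℝ} (hf : ∀ x, 0 ≤ f x) (K : ℝ) (x : Fin d → ℝ) :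
    cinf f K (cidx K x) ≤ f x := by
  apply csInf_le
  · refine ⟨0, ?_⟩
    rintro _ ⟨y, -, rfl⟩
    exact hf y
  · exact ⟨x, rfl, rfl⟩

/-- cubes used at level `k` -/
def cset (d k : ℕ) : Finset (Fin d → ℤ) :=
  Fintype.piFinset (fun _ => Finset.Icc (-((k:ℤ)+1)^2) (((k:ℤ)+1)^2))

lemma lower_tendsto {d : ℕ} {f : (Fin d → ℝ) → ℝ} (hf : ∀ x, 0 ≤ f x) (x : Fin d → ℝ)
    (hx : ContinuousAt f x) :
    Tendsto (fun k : ℕ => if cidx ((k:ℝ)+1) x ∈ cset d k then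
      cinf f ((k:ℝ)+1) (cidx ((k:ℝ)+1) x) else 0) atTop (nhds (f x)) := by
  rw [Metric.tendsto_atTop]
  intro ε hε
  obtain ⟨δ, hδ, hd⟩ := Metric.continuousAt_iff.1 hx (ε/2) (half_pos hε)
  obtain ⟨N1, hN1⟩ := exists_nat_gt (1/δ)
  obtain ⟨N2, hN2⟩ := exists_nat_gt (‖x‖ + 1)
  refine ⟨max N1 N2, fun k hk => ?_⟩
  have hk1 : (N1:ℝ) ≤ k := by exact_mod_cast (le_max_left _ _).trans hk
  have hk2 : (N2:ℝ) ≤ k := by exact_mod_cast (le_max_right _ _).trans hk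
  have hkp : (0:ℝ) < (k:ℝ)+1 := by positivity
  have hmem : cidx ((k:ℝ)+1) x ∈ cset d k := by
    rw [cset, Fintype.mem_piFinset]
    intro j
    have hxj : |x j| ≤ ‖x‖ := norm_le_pi_norm x j
    have := abs_le.1 hxj
    rw [Finset.mem_Icc]
    constructor
    · rw [cidx, Int.le_floor]; push_cast; nlinarith
    · rw [cidx, ← Int.cast_le (R := ℝ)]
      refine (Int.floor_le _).trans ?_
      push_cast; nlinarith
  rw [if_pos hmem, Real.dist_eq, abs_sub_comm, abs_of_nonneg (sub_nonneg.2 (cinf_le hf _ x))]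
  have : f x - ε/2 ≤ cinf f ((k:ℝ)+1) (cidx ((k:ℝ)+1) x) := by
    apply le_csInf
    · exact ⟨_, x, rfl, rfl⟩
    · rintro _ ⟨y, hy, rfl⟩
      have hxy : dist y x < δ := by
        rw [dist_pi_lt_iff hδ]
        intro j
        have h1 : ⌊((k:ℝ)+1) * y j⌋ = ⌊((k:ℝ)+1) * x j⌋ := congrFun hy j
        have h2 := Int.abs_sub_lt_one_of_floor_eq_floor h1
        rw [← mul_sub, abs_mul, abs_of_pos hkp] at h2
        rw [Real.dist_eq]
        have h3 : 1 < ((k:ℝ)+1) * δ := by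
          rw [div_lt_iff₀ hδ] at hN1
          nlinarith
        exact lt_of_mul_lt_mul_left (h2.trans h3) hkp.le
      have := hd hxy
      rw [Real.dist_eq, abs_lt] at this
      linarith [this.1]
  linarith

lemma lower_step {d : ℕ} {β : ℝ → ℝ} (hβ0 : ∀ t, 0 ≤ β t) (hβ1 : ∀ t, β t ≤ uind t)
    (hβi : Integrable β) {f : (Fin d → ℝ) → ℝ} (hf : ∀ x, 0 ≤ f x)
    (hfi : Integrable f) (hfc : ∀ᵐ x, ContinuousAt f x) :
    ∃ (k : ℕ) (S : Finset (Fin d → ℤ)) (a : (Fin d → ℤ) → ℝ), (∀ n, 0 ≤ a n) ∧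
      (∀ n, n ∉ S → a n = 0) ∧
      (∀ x, ∑ n ∈ S, a n * ∏ j, β (((k:ℝ)+1) * x j - n j) ≤ f x) ∧
      (∫ t, β t) ^ d / 2 * ∫ x, f x ≤
        ∫ x : Fin d → ℝ, ∑ n ∈ S, a n * ∏ j, β (((k:ℝ)+1) * x j - n j) := by
  have hm0 : 0 ≤ ∫ t, β t := integral_nonneg hβ0
  rcases (integral_nonneg (μ := volume) (f := f) hf).eq_or_lt with h0 | hpos
  · refine ⟨0, ∅, 0, by simp, by simp, by simpa using hf, ?_⟩
    rw [← h0]; simp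
  let h : ℕ → (Fin d → ℝ) → ℝ := fun k x => ∑ n ∈ cset d k, cinf f ((k:ℝ)+1) n *
    ∏ j, uind (((k:ℝ)+1) * x j - n j)
  have hh : ∀ k x, h k x = if cidx ((k:ℝ)+1) x ∈ cset d k then
      cinf f ((k:ℝ)+1) (cidx ((k:ℝ)+1) x) else 0 := fun k x => sum_uind _ _ _ _
  have hint : ∀ k, Integrable (h k) := fun k => integrable_finsetSum _
    (fun n _ => (box_integrable uind_integrable _ (by positivity) n).const_mul _)
  have hle : ∀ k x, h k x ≤ f x := by
    intro k x; rw [hh]; split_ifs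
    · exact cinf_le hf _ x
    · exact hf x
  have hnn : ∀ k x, 0 ≤ h k x := by
    intro k x; rw [hh]; split_ifs
    · exact cinf_nonneg hf _ _
    · exact le_rfl
  have hlim : Tendsto (fun k => ∫ x, h k x) atTop (nhds (∫ x, f x)) := by
    refine tendsto_integral_of_dominated_convergence f (fun k => (hint k).aestronglyMeasurable)
      hfi (fun k => .of_forall fun x => ?_) ?_
    · rw [Real.norm_of_nonneg (hnn k x)]; exact hle k x
    · filter_upwards [hfc] with x hx
      simp only [hh]
      exact lower_tendsto hf x hx
  obtain ⟨k, hk⟩ := (hlim.eventually (lt_mem_nhds (half_lt_self hpos))).exists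
  refine ⟨k, cset d k, fun n => if n ∈ cset d k then cinf f ((k:ℝ)+1) n else 0, ?_, ?_, ?_, ?_⟩
  · intro n; dsimp only; split_ifs
    · exact cinf_nonneg hf _ _
    · exact le_rfl
  · intro n hn; simp [hn]
  · intro x
    refine le_trans ?_ (hle k x)
    refine Finset.sum_le_sum fun n hn => ?_
    dsimp only
    rw [if_pos hn]
    refine mul_le_mul_of_nonneg_left ?_ (cinf_nonneg hf _ _)
    exact Finset.prod_le_prod (fun _ _ => hβ0 _) (fun _ _ => hβ1 _)
  · have e1 : ∫ x : Fin d → ℝ, ∑ n ∈ cset d k, (if n ∈ cset d k then cinf f ((k:ℝ)+1) n else 0) *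
        ∏ j, β (((k:ℝ)+1) * x j - n j) = (∫ t, β t) ^ d * ∫ x, h k x := by
      rw [integral_finsetSum, integral_finsetSum, Finset.mul_sum]
      · refine Finset.sum_congr rfl fun n hn => ?_
        rw [if_pos hn, integral_const_mul, integral_const_mul, box_integral _ _ (by positivity),
          box_integral _ _ (by positivity), uind_integral, mul_pow, mul_pow]
        ring
      · exact fun n _ => (box_integrable uind_integrable _ (by positivity) n).const_mul _
      · exact fun n _ => (box_integrable hβi _ (by positivity) n).const_mul _
    rw [e1]
    have := mul_le_mul_of_nonneg_left hk.le (pow_nonneg hm0 d)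
    linarith

/-- good residuals -/
def GoodR {d : ℕ} (f : (Fin d → ℝ) → ℝ) : Prop :=
  (∀ x, 0 ≤ f x) ∧ Integrable f ∧ ∀ᵐ x, ContinuousAt f x

lemma exists_stages {d : ℕ} {β : ℝ → ℝ} (hβ0 : ∀ t, 0 ≤ β t) (hβ1 : ∀ t, β t ≤ uind t)
    (hβi : Integrable β) (hβc : Continuous β) {f : (Fin d → ℝ) → ℝ} (hf : GoodR f) :
    ∃ (k : ℕ → ℕ) (S : ℕ → Finset (Fin d → ℤ)) (a : ℕ → (Fin d → ℤ) → ℝ),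
      (∀ s n, 0 ≤ a s n) ∧ (∀ s n, n ∉ S s → a s n = 0) ∧
      (∀ N x, ∑ s ∈ range N, ∑ n ∈ S s, a s n * ∏ j, β (((k s:ℝ)+1) * x j - n j) ≤ f x) ∧
      (∀ N, ∫ x, (f x - ∑ s ∈ range N, ∑ n ∈ S s, a s n * ∏ j, β (((k s:ℝ)+1) * x j - n j))
        ≤ (1 - (∫ t, β t) ^ d / 2) ^ N * ∫ x, f x) := by
  have key : ∀ r : {r : (Fin d → ℝ) → ℝ // GoodR r}, _ := fun r =>
    lower_step hβ0 hβ1 hβi r.2.1 r.2.2.1 r.2.2.2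
  choose k S a h1 h2 h3 h4 using key
  have gint : ∀ r, Integrable fun x : Fin d → ℝ =>
      ∑ n ∈ S r, a r n * ∏ j, β (((k r:ℝ)+1) * x j - n j) := fun r =>
    integrable_finsetSum _ (fun n _ => (box_integrable hβi _ (by positivity) n).const_mul _)
  have gcont : ∀ r, Continuous fun x : Fin d → ℝ =>
      ∑ n ∈ S r, a r n * ∏ j, β (((k r:ℝ)+1) * x j - n j) := fun r => by fun_prop
  let nxt : {r : (Fin d → ℝ) → ℝ // GoodR r} → {r : (Fin d → ℝ) → ℝ // GoodR r} := fun r =>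
    ⟨fun x => r.1 x - ∑ n ∈ S r, a r n * ∏ j, β (((k r:ℝ)+1) * x j - n j),
      fun x => sub_nonneg.2 (h3 r x), r.2.2.1.sub (gint r), by
        filter_upwards [r.2.2.2] with x hx
        exact hx.sub (gcont r).continuousAt⟩
  let R : ℕ → {r : (Fin d → ℝ) → ℝ // GoodR r} := fun N => nxt^[N] ⟨f, hf⟩
  have hR : ∀ N, R (N+1) = nxt (R N) := fun N => Function.iterate_succ_apply' _ _ _
  have hsum : ∀ N x, (R N).1 x = f x - ∑ s ∈ range N,
      ∑ n ∈ S (R s), a (R s) n * ∏ j, β (((k (R s):ℝ)+1) * x j - n j) := by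
    intro N x
    induction N with
    | zero => simp [R]
    | succ N ih => rw [hR, Finset.sum_range_succ, ← sub_sub, ← ih]
  have hm1 : ∫ t, β t ≤ 1 := by
    rw [← uind_integral]; exact integral_mono hβi uind_integrable hβ1
  have hm : (∫ t, β t) ^ d ≤ 1 := pow_le_one₀ (integral_nonneg hβ0) hm1
  refine ⟨fun s => k (R s), fun s => S (R s), fun s => a (R s), fun s => h1 _, fun s => h2 _,
    fun N x => ?_, fun N => ?_⟩
  · have := (R N).2.1 x
    rw [hsum] at this
    linarith
  · simp only [← hsum]
    induction N with
    | zero => simp [R]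
    | succ N ih =>
      rw [hR, pow_succ']
      have e : ∫ x, (nxt (R N)).1 x = (∫ x, (R N).1 x) -
          ∫ x : Fin d → ℝ, ∑ n ∈ S (R N), a (R N) n * ∏ j, β (((k (R N):ℝ)+1) * x j - n j) :=
        integral_sub (R N).2.2.1 (gint _)
      have h5 := h4 (R N)
      have h6 := mul_le_mul_of_nonneg_left ih (sub_nonneg.2 (show (∫ t, β t) ^ d / 2 ≤ 1 by linarith))
      rw [e]
      linarith

lemma sum_final {E : Type*} [MeasurableSpace E] {μ : Measure E} {f : E → ℝ} (hfi : Integrable f μ)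
    {T : ℕ → E → ℝ} (hT0 : ∀ i x, 0 ≤ T i x) (hTi : ∀ i, Integrable (T i) μ)
    (hle : ∀ (F : Finset ℕ) x, ∑ i ∈ F, T i x ≤ f x)
    (hap : ∀ ε > 0, ∃ F : Finset ℕ, ∫ x, (f x - ∑ i ∈ F, T i x) ∂μ ≤ ε) :
    HasSum (fun i => ∫ x, T i x ∂μ) (∫ x, f x ∂μ) ∧ (∀ᵐ x ∂μ, f x = ∑' i, T i x) := by
  have hsT : ∀ F : Finset ℕ, ∫ x, (f x - ∑ i ∈ F, T i x) ∂μ =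
      ∫ x, f x ∂μ - ∑ i ∈ F, ∫ x, T i x ∂μ := fun F => by
    rw [integral_sub hfi (integrable_finsetSum _ fun i _ => hTi i),
      integral_finsetSum _ fun i _ => hTi i]
  have hs : HasSum (fun i => ∫ x, T i x ∂μ) (∫ x, f x ∂μ) := by
    apply hasSum_of_isLUB_of_nonneg _ (fun i => integral_nonneg (hT0 i))
    constructor
    · rintro _ ⟨F, rfl⟩
      have := hsT F
      have h2 : 0 ≤ ∫ x, (f x - ∑ i ∈ F, T i x) ∂μ :=
        integral_nonneg fun x => sub_nonneg.2 (hle F x)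
      dsimp only
      linarith
    · intro b hb
      refine le_of_forall_pos_le_add fun ε hε => ?_
      obtain ⟨F, hF⟩ := hap ε hε
      have := hb ⟨F, rfl⟩
      dsimp only at this
      linarith [hsT F]
  refine ⟨hs, ?_⟩
  have hnorm : ∀ i, ∫ x, ‖T i x‖ ∂μ = ∫ x, T i x ∂μ := fun i =>
    integral_congr_ae (.of_forall fun x => Real.norm_of_nonneg (hT0 i x))
  have hG := hasSum_integral_of_summable_integral_norm hTi (by simpa only [hnorm] using hs.summable)
  have hGle : ∀ x, ∑' i, T i x ≤ f x := fun x =>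
    Real.tsum_le_of_sum_le (fun i => hT0 i x) (fun F => hle F x)
  have hsx : ∀ x, Summable fun i => T i x := fun x =>
    summable_of_sum_le (fun i => hT0 i x) (fun F => hle F x)
  have hGm : AEStronglyMeasurable (fun x => ∑' i, T i x) μ :=
    aestronglyMeasurable_of_tendsto_ae atTop
      (f := fun N x => ∑ i ∈ range N, T i x)
      (fun N => (integrable_finsetSum _ fun i _ => hTi i).aestronglyMeasurable)
      (.of_forall fun x => (hsx x).hasSum.tendsto_sum_nat)
  have hGi : Integrable (fun x => ∑' i, T i x) μ := by
    refine hfi.mono hGm (.of_forall fun x => ?_)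
    have h0 : 0 ≤ ∑' i, T i x := tsum_nonneg fun i => hT0 i x
    rw [Real.norm_of_nonneg h0, Real.norm_of_nonneg (h0.trans (hGle x))]
    exact hGle x
  have h0 : ∫ x, (f x - ∑' i, T i x) ∂μ = 0 := by
    rw [integral_sub hfi hGi, hs.unique hG, sub_self]
  rw [integral_eq_zero_iff_of_nonneg (fun x => sub_nonneg.2 (hGle x)) (hfi.sub hGi)] at h0
  filter_upwards [h0] with x hx
  exact sub_eq_zero.1 hx

lemma exists_beta : ∃ β : ℝ → ℝ, (∀ t, 0 ≤ β t) ∧ (∀ t, β t ≤ uind t) ∧ Integrable β ∧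
    ContDiff ℝ (⊤ : ℕ∞) β ∧ 0 < ∫ t, β t ∧ ∃ C : NNReal, LipschitzWith C β := by
  let b : ContDiffBump (1/2 : ℝ) := ⟨1/8, 1/4, by norm_num, by norm_num⟩
  refine ⟨b, fun t => b.nonneg, fun t => ?_, b.integrable, b.contDiff, b.integral_pos, ?_⟩
  · unfold uind
    split_ifs with h
    · exact b.le_one
    · refine (b.zero_of_le_dist ?_).le
      by_contra hc
      push Not at hc
      apply h
      have hc' : dist t (1/2) < 1/4 := hc
      rw [Real.dist_eq, abs_lt] at hc'
      rw [Int.floor_eq_iff]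
      constructor <;> push_cast <;> linarith [hc'.1, hc'.2]
  · exact ContDiff.lipschitzWith_of_hasCompactSupport b.hasCompactSupport
      (b.contDiff (n := 1)) (by simp)

/-- **Theorem 2 (NL-spectrum existence).** Every a.e.-continuous pdf on `ℝ^d` has a smooth
non-negative Lipschitz spectrum. -/
theorem ae_continuous_pdf_has_smooth_NL_spectrum
    (d : ℕ) (hd : 1 ≤ d) (p : (Fin d → ℝ) → ℝ)
    (hmeas : Measurable p)
    (hnn : ∀ᵐ x ∂(volume : Measure (Fin d → ℝ)), 0 ≤ p x)
    (hint : ∫ x, p x = 1)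
    (hcont : ∀ᵐ x ∂(volume : Measure (Fin d → ℝ)), ContinuousAt p x) :
    ∃ (w L : ℕ → ℝ) (q : ℕ → Fin d → ℝ → ℝ),
      (∀ i, 0 ≤ w i) ∧ HasSum w 1 ∧
      (∀ i j, IsPdf1 (q i j) ∧ ContDiff ℝ (⊤ : ℕ∞) (q i j) ∧
        (∀ x y, |q i j x - q i j y| ≤ L i * |x - y|)) ∧
      (∀ᵐ x ∂(volume : Measure (Fin d → ℝ)), p x = ∑' i, w i * ∏ j, q i j (x j)) ∧
      Tendsto (fun N => ∫ x, |p x - ∑ i ∈ range N, w i * ∏ j, q i j (x j)|)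
        atTop (nhds 0) := by
  obtain ⟨β, hβ0, hβ1, hβi, hβs, hm, C, hC⟩ := exists_beta
  have hpi : Integrable p := by
    by_contra h
    rw [integral_undef h] at hint
    exact zero_ne_one hint
  set f : (Fin d → ℝ) → ℝ := fun x => max (p x) 0 with hfdef
  have hpf : ∀ᵐ x, p x = f x := by
    filter_upwards [hnn] with x hx
    exact (max_eq_left hx).symm
  have hfi : Integrable f := hpi.congr hpf
  have hf1 : ∫ x, f x = 1 := by rw [← integral_congr_ae hpf, hint]
  have hgood : GoodR f := by
    refine ⟨fun x => le_max_right _ _, hfi, ?_⟩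
    filter_upwards [hcont] with x hx
    exact hx.max continuousAt_const
  obtain ⟨k, S, a, ha0, haS, hle, hap⟩ := exists_stages hβ0 hβ1 hβi hβs.continuous hgood
  obtain ⟨e⟩ : Nonempty (ℕ ≃ ℕ × (Fin d → ℤ)) := by
    obtain ⟨i⟩ := nonempty_denumerable (ℕ × (Fin d → ℤ))
    exact ⟨(Denumerable.eqv _).symm⟩
  set m := ∫ t, β t with hmdef
  have hKp : ∀ s, (0:ℝ) < (k s:ℝ) + 1 := fun s => by positivity
  let T : ℕ → (Fin d → ℝ) → ℝ := fun i x =>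
    a (e i).1 (e i).2 * ∏ j, β (((k (e i).1:ℝ)+1) * x j - (e i).2 j)
  let q : ℕ → Fin d → ℝ → ℝ := fun i j t =>
    (((k (e i).1:ℝ)+1) / m) * β (((k (e i).1:ℝ)+1) * t - (e i).2 j)
  let w : ℕ → ℝ := fun i => a (e i).1 (e i).2 * ((((k (e i).1:ℝ)+1))⁻¹ * m) ^ d
  have hTi : ∀ i, Integrable (T i) := fun i =>
    (box_integrable hβi _ (hKp _).ne' _).const_mul _
  have hT0 : ∀ i x, 0 ≤ T i x := fun i x =>
    mul_nonneg (ha0 _ _) (Finset.prod_nonneg fun _ _ => hβ0 _)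
  have hTint : ∀ i, ∫ x, T i x = w i := fun i => by
    simp only [T, w]
    rw [integral_const_mul, box_integral _ _ (hKp _)]
  have hTq : ∀ i x, w i * ∏ j, q i j (x j) = T i x := fun i x => by
    simp only [w, q, T]
    rw [Finset.prod_mul_distrib, Finset.prod_const, Finset.card_univ, Fintype.card_fin, mul_assoc,
      ← mul_assoc (_ ^ d) (_ ^ d), ← mul_pow]
    have : (((k (e i).1:ℝ)+1))⁻¹ * m * ((((k (e i).1:ℝ)+1)) / m) = 1 := by
      have := (hKp (e i).1).ne'
      have := hm.ne'
      field_simp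
    rw [this, one_pow, one_mul]
  let G : ℕ × (Fin d → ℤ) → (Fin d → ℝ) → ℝ := fun c x =>
    a c.1 c.2 * ∏ j, β (((k c.1:ℝ)+1) * x j - c.2 j)
  have hG0 : ∀ c x, 0 ≤ G c x := fun c x =>
    mul_nonneg (ha0 _ _) (Finset.prod_nonneg fun _ _ => hβ0 _)
  have hstage : ∀ N x, ∑ s ∈ range N, ∑ n ∈ S s, a s n * ∏ j, β (((k s:ℝ)+1) * x j - n j)
      = ∑ c ∈ ((range N).sigma S).map (Equiv.sigmaEquivProd ℕ (Fin d → ℤ)).toEmbedding, G c x := by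
    intro N x
    rw [Finset.sum_map, Finset.sum_sigma]
    rfl
  have hTle : ∀ (F : Finset ℕ) x, ∑ i ∈ F, T i x ≤ f x := by
    intro F x
    obtain ⟨N, hN⟩ : ∃ N, ∀ i ∈ F, (e i).1 < N := by
      refine ⟨F.sup (fun i => (e i).1) + 1, fun i hi => ?_⟩
      exact Nat.lt_succ_of_le (Finset.le_sup (f := fun i => (e i).1) hi)
    refine le_trans ?_ (hle N x)
    rw [hstage]
    have : ∑ i ∈ F, T i x = ∑ c ∈ F.map e.toEmbedding, G c x := by
      rw [Finset.sum_map]; rfl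
    rw [this]
    rw [← Finset.sum_filter_ne_zero]
    refine Finset.sum_le_sum_of_subset_of_nonneg (fun c hc' => ?_) (fun c _ _ => hG0 c x)
    obtain ⟨hc, hne⟩ := Finset.mem_filter.1 hc'
    obtain ⟨i, hi, rfl⟩ := Finset.mem_map.1 hc
    rw [Finset.mem_map]
    refine ⟨⟨(e i).1, (e i).2⟩, ?_, rfl⟩
    rw [Finset.mem_sigma]
    refine ⟨Finset.mem_range.2 (hN i hi), ?_⟩
    by_contra h
    apply hne
    simp only [G]
    rw [Equiv.coe_toEmbedding, haS _ _ h, zero_mul]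
  have hm1 : m ≤ 1 := by
    rw [← uind_integral]; exact integral_mono hβi uind_integrable hβ1
  have hTap : ∀ ε > 0, ∃ F : Finset ℕ, ∫ x, (f x - ∑ i ∈ F, T i x) ≤ ε := by
    intro ε hε
    have hmd : m ^ d ≤ 1 := pow_le_one₀ hm.le hm1
    have hmd0 : 0 < m ^ d := pow_pos hm d
    obtain ⟨N, hN⟩ := exists_pow_lt_of_lt_one hε (show 1 - m ^ d / 2 < 1 by linarith)
    refine ⟨(((range N).sigma S).map (Equiv.sigmaEquivProd ℕ (Fin d → ℤ)).toEmbedding).map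
      e.symm.toEmbedding, ?_⟩
    have h1 := hap N
    rw [hf1, mul_one] at h1
    refine le_trans (le_of_eq ?_) (h1.trans hN.le)
    congr 1
    funext x
    rw [hstage, Finset.sum_map]
    congr 1
    refine Finset.sum_congr rfl fun c _ => ?_
    simp [T, G]
  obtain ⟨hsum, hae⟩ := sum_final hfi hT0 hTi hTle hTap
  simp only [hTint, hf1] at hsum
  refine ⟨w, fun i => (((k (e i).1:ℝ)+1) / m) * (C * ((k (e i).1:ℝ)+1)), q, fun i => ?_, hsum,
    fun i j => ⟨⟨?_, ?_, ?_⟩, ?_, ?_⟩, ?_, ?_⟩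
  · rw [← hTint]; exact integral_nonneg (hT0 i)
  · have := hβs.continuous
    exact Continuous.measurable (by fun_prop)
  · exact .of_forall fun t => mul_nonneg (div_nonneg (hKp _).le hm.le) (hβ0 _)
  · simp only [q]
    rw [integral_const_mul, resc_integral _ _ (hKp _)]
    have := (hKp (e i).1).ne'
    have := hm.ne'
    field_simp
    exact hmdef.symm
  · exact contDiff_const.mul (hβs.comp ((contDiff_const.mul contDiff_id).sub contDiff_const))
  · intro x y
    simp only [q]
    have hq : 0 ≤ ((k (e i).1:ℝ)+1) / m := div_nonneg (hKp _).le hm.le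
    rw [← mul_sub, abs_mul, abs_of_nonneg hq, mul_assoc]
    refine mul_le_mul_of_nonneg_left ?_ hq
    have := hC.dist_le_mul (((k (e i).1:ℝ)+1) * x - (e i).2 j) (((k (e i).1:ℝ)+1) * y - (e i).2 j)
    rw [Real.dist_eq, Real.dist_eq, sub_sub_sub_cancel_right, ← mul_sub, abs_mul,
      abs_of_pos (hKp _)] at this
    linarith
  · filter_upwards [hpf, hae] with x h1 h2
    simp only [hTq]
    rw [h1, h2]
  · have heq : ∀ N, ∫ x, |p x - ∑ i ∈ range N, w i * ∏ j, q i j (x j)| =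
        1 - ∑ i ∈ range N, w i := by
      intro N
      have : ∫ x, |p x - ∑ i ∈ range N, w i * ∏ j, q i j (x j)| =
          ∫ x, (f x - ∑ i ∈ range N, T i x) := by
        refine integral_congr_ae ?_
        filter_upwards [hpf] with x h1
        simp only [hTq]
        rw [h1, abs_of_nonneg (sub_nonneg.2 (hTle _ x))]
      rw [this, integral_sub hfi (integrable_finsetSum _ fun i _ => hTi i),
        integral_finsetSum _ fun i _ => hTi i, hf1]
      simp only [hTint]
    simp only [heq]
    simpa using hsum.tendsto_sum_nat.const_sub 1
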